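/- arXiv:1907.12075 — 6 statements merged into one kernel-verified Lean document; each statement's English description precedes it below -/
import Mathlib

section
/- Suppose there exists k* ∈ ℕ such that φ(k*+1, x) ∈ X for every x ∈ X. Then O_{k*} is positively invariant (f maps O_{k*} into O_{k*}), O_k = O_{k*} for every k ≥ k*, and O_{k*} = O_∞. -/
/-- The sets obtained by intersecting repeatedly with the preimage, starting from `X`, consist of the
points whose first `k` iterates stay in `X`. -/
theorem mem_iff_forall_le_iterate_mem {α : Type*} {f : α → α} {X : Set α} {O : ℕ → Set α}
    (hO0 : O 0 = X) (hOs : ∀ k : ℕ, O (k + 1) = O k ∩ {x | f x ∈ O k}) (k : ℕ) (x : α) :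
    x ∈ O k ↔ ∀ j ≤ k, f^[j] x ∈ X := by
  induction k generalizing x with
  | zero => simp [hO0]
  | succ k ih =>
    rw [hOs, Set.mem_inter_iff, Set.mem_ofPred_eq, ih, ih]
    constructor
    · rintro ⟨h₁, h₂⟩ (_ | j) hj
      · exact h₁ 0 (Nat.zero_le k)
      · exact h₂ j (by omega)
    · exact fun h => ⟨fun j hj => h j (by omega), fun j hj => h (j + 1) (by omega)⟩

/-- If `f^[m + 1]` maps `X` into itself, an orbit whose first `m` iterates stay in `X` never
leaves `X`. -/
theorem iterate_mem_of_forall_le {α : Type*} {f : α → α} {X : Set α} {m : ℕ}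
    (hm : ∀ x ∈ X, f^[m + 1] x ∈ X) {x : α} (hx : ∀ j ≤ m, f^[j] x ∈ X) (j : ℕ) :
    f^[j] x ∈ X := by
  induction j using Nat.strong_induction_on with
  | _ j ih =>
    rcases le_or_gt j m with hj | hj
    · exact hx j hj
    · obtain ⟨i, rfl⟩ := Nat.exists_eq_add_of_le (Nat.succ_le_of_lt hj)
      rw [Nat.succ_eq_add_one, Function.iterate_add_apply]
      exact hm _ (ih i (by omega))

/-- If there is `k*` with `f^[k*+1] x ∈ X` for all `x ∈ X`, then `O_{k*}` is
positively invariant, `O_k = O_{k*}` for all `k ≥ k*`, and `O_{k*} = O_∞`. -/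
theorem invariance_horizon {n : ℕ}
    (f : EuclideanSpace ℝ (Fin n) → EuclideanSpace ℝ (Fin n))
    (X : Set (EuclideanSpace ℝ (Fin n)))
    (O : ℕ → Set (EuclideanSpace ℝ (Fin n)))
    (hO0 : O 0 = X) (hOs : ∀ k : ℕ, O (k + 1) = O k ∩ {x | f x ∈ O k})
    (kstar : ℕ) (hkstar : ∀ x ∈ X, f^[kstar + 1] x ∈ X) :
    Set.MapsTo f (O kstar) (O kstar) ∧
      (∀ k : ℕ, kstar ≤ k → O k = O kstar) ∧
      O kstar = {x | ∀ k : ℕ, f^[k] x ∈ X} := by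
  have hmem := mem_iff_forall_le_iterate_mem hO0 hOs
  have horbit : ∀ x ∈ O kstar, ∀ j, f^[j] x ∈ X := fun x hx =>
    iterate_mem_of_forall_le hkstar ((hmem kstar x).1 hx)
  refine ⟨fun x hx => ?_, fun k hk => ?_, ?_⟩
  · exact (hmem kstar (f x)).2 fun j _ => horbit x hx (j + 1)
  · ext x
    exact ⟨fun hx => (hmem kstar x).2 fun j hj => (hmem k x).1 hx j (hj.trans hk),
      fun hx => (hmem k x).2 fun j _ => horbit x hx j⟩
  · ext x
    exact ⟨horbit x, fun hx => (hmem kstar x).2 fun j _ => hx j⟩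
end

section
/- For every integer N ≥ 1 and every ε ∈ (0,1], the product measure of the set of samples whose empirically estimated invariance horizon still violates invariance by at least ε satisfies μᴺ({ω ∈ Xᴺ : S(t̄(ω)) ≥ ε}) ≤ (1/ε)·(1−ε)ᴺ. -/
open MeasureTheory

open scoped Classical in
/-- Empirical fraction of sample points lying in `O k`. -/
noncomputable def empFrac {X : Type*} (O : ℕ → Set X) {N : ℕ} (ω : Fin N → X) (k : ℕ) : ℝ :=
  ((Finset.univ.filter fun i => ω i ∈ O k).card : ℝ) / N

/-- The empirically estimated invariance horizon: the least `k` with `θ_k(ω) = θ_{k+1}(ω)`. -/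
noncomputable def tbar {X : Type*} (O : ℕ → Set X) {N : ℕ} (ω : Fin N → X) : ℕ :=
  sInf {k : ℕ | empFrac O ω k = empFrac O ω (k + 1)}

open scoped ENNReal

theorem empFrac_eq_iff {X : Type*} {O : ℕ → Set X} (hO : Antitone O) {N : ℕ} (ω : Fin N → X)
    {j k : ℕ} (hjk : j ≤ k) :
    empFrac O ω j = empFrac O ω k ↔ ∀ i, ω i ∉ O j \ O k := by
  classical
  rcases Nat.eq_zero_or_pos N with rfl | hN
  · simp [empFrac]
  have hsub : (Finset.univ.filter fun i => ω i ∈ O k) ⊆ Finset.univ.filter fun i => ω i ∈ O j :=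
    Finset.monotone_filter_right _ fun i _ hi => hO hjk hi
  have hN' : (N : ℝ) ≠ 0 := by positivity
  have hcard : empFrac O ω j = empFrac O ω k ↔
      (Finset.univ.filter fun i => ω i ∈ O j).card =
        (Finset.univ.filter fun i => ω i ∈ O k).card := by
    unfold empFrac
    rw [div_left_inj' hN', Nat.cast_inj]
  rw [hcard]
  constructor
  · intro h i hi
    have heq := Finset.eq_of_subset_of_card_le hsub h.le
    have hmem : i ∈ Finset.univ.filter fun i => ω i ∈ O k := heq ▸ by simpa using hi.1
    exact hi.2 (by simpa using hmem)
  · intro h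
    congr 1
    refine Finset.Subset.antisymm (fun i hi => ?_) hsub
    simp only [Finset.mem_filter, Finset.mem_univ, true_and] at hi ⊢
    by_contra hk
    exact h i ⟨hi, hk⟩

theorem exists_empFrac_eq_succ {X : Type*} {O : ℕ → Set X} (hO : Antitone O) {N : ℕ}
    (ω : Fin N → X) : ∃ k, empFrac O ω k = empFrac O ω (k + 1) := by
  by_contra! h
  have hex : ∀ k, ∃ i, ω i ∈ O k \ O (k + 1) := fun k => by
    by_contra! hk
    exact h k ((empFrac_eq_iff hO ω k.le_succ).2 hk)
  choose f hf using hex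
  refine not_injective_infinite_finite f fun a b hab => ?_
  have hlt : ∀ a b, a < b → f a ≠ f b := fun a b hlt heq =>
    (hf a).2 (hO (Nat.succ_le_of_lt hlt) (heq ▸ (hf b).1))
  rcases lt_trichotomy a b with hl | rfl | hl
  · exact absurd hab (hlt a b hl)
  · rfl
  · exact absurd hab.symm (hlt b a hl)

theorem notMem_diff_tbar {X : Type*} {O : ℕ → Set X} (hO : Antitone O) {N : ℕ}
    (ω : Fin N → X) (i : Fin N) : ω i ∉ O (tbar O ω) \ O (tbar O ω + 1) :=
  (empFrac_eq_iff hO ω (Nat.le_succ _)).1 (Nat.sInf_mem (exists_empFrac_eq_succ hO ω)) i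

/-- A sample of size `N` misses a set of probability at least `ε` with probability at most
`(1 - ε) ^ N`. -/
theorem measure_pi_forall_notMem_le {X : Type*} [MeasurableSpace X] (μ : Measure X)
    [IsProbabilityMeasure μ] {D : Set X} (hD : MeasurableSet D) (N : ℕ) {ε : ℝ≥0∞}
    (hε : ε ≤ μ D) :
    (Measure.pi fun _ : Fin N => μ) {ω | ∀ i, ω i ∉ D} ≤ (1 - ε) ^ N := by
  have hset : {ω : Fin N → X | ∀ i, ω i ∉ D} = Set.univ.pi fun _ => Dᶜ := by
    ext ω
    simp
  rw [hset, Measure.pi_pi, Finset.prod_const, Finset.card_univ, Fintype.card_fin,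
    prob_compl_eq_one_sub hD]
  gcongr

theorem measure_pi_exists_missed_le {X ι : Type*} [MeasurableSpace X] (μ : Measure X)
    [IsProbabilityMeasure μ] {D : ι → Set X} (hD : ∀ k, MeasurableSet (D k))
    (hdisj : Pairwise (Function.onFun Disjoint D)) (N : ℕ) {ε : ℝ≥0∞} (hε : ε ≠ 0) :
    (Measure.pi fun _ : Fin N => μ) {ω | ∃ k, ε ≤ μ (D k) ∧ ∀ i, ω i ∉ D k} ≤
      ε⁻¹ * (1 - ε) ^ N := by
  have hfin : {k | ε ≤ μ (D k)}.Finite :=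
    Measure.finite_const_le_meas_of_disjoint_iUnion μ (pos_iff_ne_zero.2 hε) hD hdisj
      (measure_ne_top _ _)
  have hmem : ∀ k ∈ hfin.toFinset, ε ≤ μ (D k) := fun k hk => by simpa using hk
  have hcard : (hfin.toFinset.card : ℝ≥0∞) ≤ ε⁻¹ := by
    rw [ENNReal.le_inv_iff_mul_le, ← nsmul_eq_mul]
    calc hfin.toFinset.card • ε ≤ ∑ k ∈ hfin.toFinset, μ (D k) :=
          Finset.card_nsmul_le_sum _ _ _ hmem
      _ = μ (⋃ k ∈ hfin.toFinset, D k) :=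
          (measure_biUnion_finset (fun a _ b _ hab => hdisj hab) fun k _ => hD k).symm
      _ ≤ 1 := prob_le_one
  calc (Measure.pi fun _ : Fin N => μ) {ω | ∃ k, ε ≤ μ (D k) ∧ ∀ i, ω i ∉ D k}
      ≤ (Measure.pi fun _ : Fin N => μ) (⋃ k ∈ hfin.toFinset, {ω | ∀ i, ω i ∉ D k}) := by
        refine measure_mono fun ω ⟨k, hk, hω⟩ => ?_
        simp only [Set.mem_iUnion]
        exact ⟨k, by simpa using hk, hω⟩
    _ ≤ ∑ k ∈ hfin.toFinset, (Measure.pi fun _ : Fin N => μ) {ω | ∀ i, ω i ∉ D k} :=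
        measure_biUnion_finset_le _ _
    _ ≤ hfin.toFinset.card • (1 - ε) ^ N :=
        Finset.sum_le_card_nsmul _ _ _ fun k hk =>
          measure_pi_forall_notMem_le μ (hD k) N (hmem k hk)
    _ ≤ ε⁻¹ * (1 - ε) ^ N := by
        rw [nsmul_eq_mul]
        gcongr

theorem pairwise_disjoint_diff_succ {X : Type*} {O : ℕ → Set X} (hO : Antitone O) :
    Pairwise (Function.onFun Disjoint fun k => O k \ O (k + 1)) := by
  refine (pairwise_disjoint_on _).2 fun m n hmn => ?_
  exact Set.disjoint_left.2 fun x hm hn => hm.2 (hO (Nat.succ_le_of_lt hmn) hn.1)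

/-- For every `N ≥ 1` and `ε ∈ (0,1]`,
`μᴺ({ω : S(t̄(ω)) ≥ ε}) ≤ (1/ε)·(1-ε)^N`. -/
theorem scenario_bound_tbar {X : Type*} [MeasurableSpace X] (μ : Measure X)
    [IsProbabilityMeasure μ] (O : ℕ → Set X)
    (hOmeas : ∀ k : ℕ, MeasurableSet (O k)) (hOanti : ∀ k : ℕ, O (k + 1) ⊆ O k)
    (hO0 : O 0 = Set.univ)
    (N : ℕ) (hN : 1 ≤ N) (ε : ℝ) (hε0 : 0 < ε) (hε1 : ε ≤ 1) :
    (Measure.pi fun _ : Fin N => μ)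
        {ω : Fin N → X | ENNReal.ofReal ε ≤ μ (O (tbar O ω) \ O (tbar O ω + 1))} ≤
      ENNReal.ofReal ((1 / ε) * (1 - ε) ^ N) := by
  have hO : Antitone O := antitone_nat_of_succ_le hOanti
  have hbound : ENNReal.ofReal ((1 / ε) * (1 - ε) ^ N) =
      (ENNReal.ofReal ε)⁻¹ * (1 - ENNReal.ofReal ε) ^ N := by
    rw [ENNReal.ofReal_mul (by positivity), one_div, ENNReal.ofReal_inv_of_pos hε0,
      ENNReal.ofReal_pow (by linarith), ENNReal.ofReal_sub _ hε0.le, ENNReal.ofReal_one]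
  rw [hbound]
  refine le_trans (measure_mono fun ω hω => ?_)
    (measure_pi_exists_missed_le μ (D := fun k => O k \ O (k + 1))
      (fun k => (hOmeas k).diff (hOmeas (k + 1))) (pairwise_disjoint_diff_succ hO) N
      (ENNReal.ofReal_pos.2 hε0).ne')
  exact ⟨tbar O ω, hω, notMem_diff_tbar hO ω⟩
end

section
/- For every integer N ≥ 1 and every ε ∈ (0,1], μᴺ({ω ∈ Xᴺ : S(t*(ω)) ≥ ε}) ≤ μᴺ({ω ∈ Xᴺ : μ(O_{t*(ω)} \ O_∞) ≥ ε}) ≤ (1−ε)ᴺ. -/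
open MeasureTheory

open scoped Classical in
/-- The exit index: `τ(x) = k+1` if `x ∈ O_k \ O_{k+1}` and `τ(x) = 0` if `x ∈ O_∞`. -/
noncomputable def exitIndex {X : Type*} (O : ℕ → Set X) (x : X) : ℕ :=
  if x ∈ ⋂ k : ℕ, O k then 0 else sInf {k : ℕ | x ∉ O k}

/-- The maximal exit index of the sample `ω`. -/
noncomputable def tstar {X : Type*} (O : ℕ → Set X) {N : ℕ} (ω : Fin N → X) : ℕ :=
  Finset.univ.sup fun i => exitIndex O (ω i)

/-- A point whose exit index is at most `k` does not lie in `O k \ O_∞`. -/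
lemma notMem_diff_iInter_of_exitIndex_le {X : Type*} {O : ℕ → Set X} (hO : Antitone O) {x : X}
    {k : ℕ} (h : exitIndex O x ≤ k) : x ∉ O k \ ⋂ j : ℕ, O j := by
  rintro ⟨hxk, hx⟩
  rw [exitIndex, if_neg hx] at h
  have hne : {j : ℕ | x ∉ O j}.Nonempty := by
    simpa [Set.Nonempty, Set.mem_iInter] using hx
  exact Nat.sInf_mem hne (hO h hxk)

/-- The tails `O k \ O_∞` of an antitone sequence have vanishing measure. -/
lemma tendsto_measure_diff_iInter {X : Type*} [MeasurableSpace X] (μ : Measure X)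
    [IsFiniteMeasure μ] {O : ℕ → Set X} (hOmeas : ∀ k : ℕ, MeasurableSet (O k))
    (hO : Antitone O) :
    Filter.Tendsto (fun k => μ (O k \ ⋂ j : ℕ, O j)) Filter.atTop (nhds 0) := by
  have h := tendsto_measure_iInter_atTop (μ := μ) (s := fun k => O k \ ⋂ j : ℕ, O j)
    (fun k => ((hOmeas k).diff (MeasurableSet.iInter hOmeas)).nullMeasurableSet)
    (fun _ _ hij => Set.sdiff_subset_sdiff_left (hO hij)) ⟨0, measure_ne_top _ _⟩
  have hempty : ⋂ k : ℕ, (O k \ ⋂ j : ℕ, O j) = ∅ := by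
    ext x
    simp only [Set.mem_iInter, Set.mem_sdiff, Set.mem_empty_iff_false, iff_false]
    exact fun hx => (hx 0).2 fun j => (hx j).1
  rwa [hempty, measure_empty] at h

/-- An upper bound for the probability that all `N` samples have exit index at most `k`. -/
lemma pi_tstar_le_le {X : Type*} [MeasurableSpace X] (μ : Measure X) [IsProbabilityMeasure μ]
    {O : ℕ → Set X} (hOmeas : ∀ k : ℕ, MeasurableSet (O k)) (hO : Antitone O) (N k : ℕ) :
    (Measure.pi fun _ : Fin N => μ) {ω : Fin N → X | tstar O ω ≤ k} ≤
      (1 - μ (O k \ ⋂ j : ℕ, O j)) ^ N := by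
  have hsub : {ω : Fin N → X | tstar O ω ≤ k} ⊆
      Set.univ.pi fun _ => (O k \ ⋂ j : ℕ, O j)ᶜ := fun ω hω i _ =>
    notMem_diff_iInter_of_exitIndex_le hO
      ((Finset.le_sup (f := fun i => exitIndex O (ω i)) (Finset.mem_univ i)).trans hω)
  refine (measure_mono hsub).trans_eq ?_
  rw [Measure.pi_pi, Finset.prod_const, Finset.card_univ, Fintype.card_fin,
    prob_compl_eq_one_sub ((hOmeas k).diff (MeasurableSet.iInter hOmeas))]

/-- For every `N ≥ 1` and `ε ∈ (0,1]`,
`μᴺ({ω : S(t*(ω)) ≥ ε}) ≤ μᴺ({ω : μ(O_{t*(ω)} \ O_∞) ≥ ε}) ≤ (1-ε)^N`. -/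
theorem scenario_bound_tstar {X : Type*} [MeasurableSpace X] (μ : Measure X)
    [IsProbabilityMeasure μ] (O : ℕ → Set X)
    (hOmeas : ∀ k : ℕ, MeasurableSet (O k)) (hOanti : ∀ k : ℕ, O (k + 1) ⊆ O k)
    (hO0 : O 0 = Set.univ)
    (N : ℕ) (hN : 1 ≤ N) (ε : ℝ) (hε0 : 0 < ε) (hε1 : ε ≤ 1) :
    (Measure.pi fun _ : Fin N => μ)
        {ω : Fin N → X | ENNReal.ofReal ε ≤ μ (O (tstar O ω) \ O (tstar O ω + 1))} ≤
      (Measure.pi fun _ : Fin N => μ)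
        {ω : Fin N → X | ENNReal.ofReal ε ≤ μ (O (tstar O ω) \ ⋂ k : ℕ, O k)} ∧
    (Measure.pi fun _ : Fin N => μ)
        {ω : Fin N → X | ENNReal.ofReal ε ≤ μ (O (tstar O ω) \ ⋂ k : ℕ, O k)} ≤
      ENNReal.ofReal ((1 - ε) ^ N) := by
  have hO : Antitone O := antitone_nat_of_succ_le hOanti
  refine ⟨measure_mono fun ω hω => le_trans hω
    (measure_mono (Set.sdiff_subset_sdiff_right (Set.iInter_subset O _))), ?_⟩
  have hex : ∃ m, μ (O m \ ⋂ j : ℕ, O j) < ENNReal.ofReal ε :=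
    ((tendsto_measure_diff_iInter μ hOmeas hO).eventually_lt_const
      (ENNReal.ofReal_pos.2 hε0)).exists
  classical
  have hlt : ∀ ω : Fin N → X, ENNReal.ofReal ε ≤ μ (O (tstar O ω) \ ⋂ k : ℕ, O k) →
      tstar O ω < Nat.find hex := by
    intro ω hω
    by_contra! hle
    exact absurd (hω.trans (measure_mono (Set.sdiff_subset_sdiff_left (hO hle))))
      (not_le.2 (Nat.find_spec hex))
  rcases hk : Nat.find hex with _ | k
  · have hempty : {ω : Fin N → X | ENNReal.ofReal ε ≤ μ (O (tstar O ω) \ ⋂ k : ℕ, O k)} = ∅ :=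
      Set.eq_empty_of_forall_notMem fun ω hω => by
        have := hlt ω hω
        omega
    simp [hempty]
  · have hεk : ENNReal.ofReal ε ≤ μ (O k \ ⋂ j : ℕ, O j) :=
      not_lt.1 (Nat.find_min hex (by omega))
    calc (Measure.pi fun _ : Fin N => μ)
          {ω : Fin N → X | ENNReal.ofReal ε ≤ μ (O (tstar O ω) \ ⋂ k : ℕ, O k)}
        ≤ (Measure.pi fun _ : Fin N => μ) {ω : Fin N → X | tstar O ω ≤ k} :=
          measure_mono fun ω hω => Nat.le_of_lt_succ ((hlt ω hω).trans_eq hk)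
      _ ≤ (1 - μ (O k \ ⋂ j : ℕ, O j)) ^ N := pi_tstar_le_le μ hOmeas hO N k
      _ ≤ (1 - ENNReal.ofReal ε) ^ N := by gcongr
      _ = ENNReal.ofReal ((1 - ε) ^ N) := by
          rw [ENNReal.ofReal_pow (sub_nonneg.2 hε1), ENNReal.ofReal_sub _ hε0.le,
            ENNReal.ofReal_one]
end

section
/- Let X ⊆ ℝⁿ be compact, let O ⊆ X be nonempty and compact, let A ⊆ O and B ⊆ X\O be nonempty, and let δ > 0. If O ⊆ A + δ𝓑ₙ and X\O ⊆ B + δ𝓑ₙ, then Π(A,B,−δ) ⊆ O ⊆ Π(A,B,δ). -/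
open scoped Pointwise

/-- `Π(S₁, S₂, r) = {x ∈ X : d(x,S₁) − d(x,S₂) ≤ r}`. -/
def sepSet {n : ℕ} (X S₁ S₂ : Set (EuclideanSpace ℝ (Fin n))) (r : ℝ) :
    Set (EuclideanSpace ℝ (Fin n)) :=
  {x ∈ X | Metric.infDist x S₁ - Metric.infDist x S₂ ≤ r}

theorem infDist_le_of_mem_add_closedBall {E : Type*} [SeminormedAddCommGroup E] {S : Set E}
    {x : E} {δ : ℝ} (hx : x ∈ S + Metric.closedBall (0 : E) δ) : Metric.infDist x S ≤ δ := by
  obtain ⟨s, hs, z, hz, rfl⟩ := Set.mem_add.1 hx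
  exact (Metric.infDist_le_dist_of_mem hs).trans (by simpa [dist_eq_norm] using hz)

/-- If `X` is compact, `O ⊆ X` is nonempty compact, `A ⊆ O` and `B ⊆ X\O`
are nonempty, `δ > 0`, `O ⊆ A + δ𝓑ₙ` and `X\O ⊆ B + δ𝓑ₙ`, then
`Π(A,B,−δ) ⊆ O ⊆ Π(A,B,δ)`. -/
theorem sepSet_inner_outer {n : ℕ} (X O A B : Set (EuclideanSpace ℝ (Fin n)))
    (hX : IsCompact X) (hOne : O.Nonempty) (hO : IsCompact O) (hOX : O ⊆ X)
    (hAO : A ⊆ O) (hAne : A.Nonempty) (hB : B ⊆ X \ O) (hBne : B.Nonempty)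
    (δ : ℝ) (hδ : 0 < δ)
    (hOA : O ⊆ A + Metric.closedBall (0 : EuclideanSpace ℝ (Fin n)) δ)
    (hXB : X \ O ⊆ B + Metric.closedBall (0 : EuclideanSpace ℝ (Fin n)) δ) :
    sepSet X A B (-δ) ⊆ O ∧ O ⊆ sepSet X A B δ := by
  constructor
  · rintro x ⟨hxX, hx⟩
    by_contra hxO
    have hxB := infDist_le_of_mem_add_closedBall (hXB ⟨hxX, hxO⟩)
    have hxA : Metric.infDist x A = 0 :=
      le_antisymm (by linarith) Metric.infDist_nonneg
    exact hxO (closure_minimal hAO hO.isClosed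
      ((Metric.mem_closure_iff_infDist_zero hAne).2 hxA))
  · intro x hxO
    have hxA := infDist_le_of_mem_add_closedBall (hOA hxO)
    have hxB : 0 ≤ Metric.infDist x B := Metric.infDist_nonneg
    exact ⟨hOX hxO, by linarith⟩
end

section
/- Let (X, 𝔉, μ) be a probability space and h : X → ℝ a measurable function. For an integer N ≥ 1 and a sample ω = (x₁,…,x_N) ∈ Xᴺ, let δ*(ω) := max_{1≤i≤N} h(x_i). Then for every ε ∈ (0,1], the violation probability of the sampled maximum satisfies μᴺ({ω ∈ Xᴺ : μ({x ∈ X : h(x) > δ*(ω)}) > ε}) ≤ (1−ε)ᴺ. -/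
open MeasureTheory

/-- The sampled maximum `δ*(ω) = max_{1 ≤ i ≤ N} h(x_i)`. -/
noncomputable def sampledMax {X : Type*} (h : X → ℝ) {N : ℕ} (hN : 1 ≤ N)
    (ω : Fin N → X) : ℝ :=
  Finset.univ.sup' ⟨⟨0, hN⟩, Finset.mem_univ _⟩ fun i => h (ω i)

/-- The set of levels that a real law exceeds with probability more than `ε` has mass at most
`1 - ε`. -/
theorem measure_setOf_lt_measure_Ioi_le (ν : Measure ℝ) [IsProbabilityMeasure ν]
    (ε : ENNReal) : ν {t : ℝ | ε < ν (Set.Ioi t)} ≤ 1 - ε := by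
  have hlow : IsLowerSet {t : ℝ | ε < ν (Set.Ioi t)} := fun a b hba ha =>
    lt_of_lt_of_le ha (measure_mono (Set.Ioi_subset_Ioi hba))
  rw [hlow.ordConnected.measurableSet.measure_eq_iSup_isCompact]
  refine iSup₂_le fun K hKS => iSup_le fun hK => ?_
  rcases K.eq_empty_or_nonempty with rfl | hne
  · simp
  obtain ⟨m, hmK, hm⟩ := hK.exists_isGreatest hne
  calc ν K ≤ ν (Set.Ioi m)ᶜ := measure_mono fun t ht => by simpa using hm ht
    _ = 1 - ν (Set.Ioi m) := prob_compl_eq_one_sub measurableSet_Ioi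
    _ ≤ 1 - ε := tsub_le_tsub_left (hKS hmK).le 1

/-- For every `ε ∈ (0,1]`,
`μᴺ({ω : μ({x : h(x) > δ*(ω)}) > ε}) ≤ (1-ε)^N`. -/
theorem scenario_max_bound {X : Type*} [MeasurableSpace X] (μ : Measure X)
    [IsProbabilityMeasure μ] (h : X → ℝ) (hh : Measurable h)
    (N : ℕ) (hN : 1 ≤ N) (ε : ℝ) (hε0 : 0 < ε) (hε1 : ε ≤ 1) :
    (Measure.pi fun _ : Fin N => μ)
        {ω : Fin N → X | ENNReal.ofReal ε < μ {x : X | sampledMax h hN ω < h x}} ≤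
      ENNReal.ofReal ((1 - ε) ^ N) := by
  set B : Set X := {x | ENNReal.ofReal ε < μ {y | h x < h y}}
  have hBle : μ B ≤ ENNReal.ofReal (1 - ε) := by
    have := Measure.isProbabilityMeasure_map (μ := μ) hh.aemeasurable
    have hν (t : ℝ) : μ.map h (Set.Ioi t) = μ {y | t < h y} :=
      Measure.map_apply hh measurableSet_Ioi
    calc μ B ≤ μ.map h {t : ℝ | ENNReal.ofReal ε < μ.map h (Set.Ioi t)} := by
          refine le_trans (measure_mono fun x hx => ?_) (Measure.le_map_apply hh.aemeasurable _)
          change ENNReal.ofReal ε < μ.map h (Set.Ioi (h x))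
          rwa [hν]
      _ ≤ 1 - ENNReal.ofReal ε := measure_setOf_lt_measure_Ioi_le _ _
      _ = ENNReal.ofReal (1 - ε) := by
          rw [ENNReal.ofReal_sub 1 hε0.le, ENNReal.ofReal_one]
  calc _ ≤ (Measure.pi fun _ : Fin N => μ) (Set.univ.pi fun _ => B) := by
        refine measure_mono fun ω hω i _ => lt_of_lt_of_le hω (measure_mono fun x hx => ?_)
        exact lt_of_le_of_lt (Finset.le_sup' (fun i => h (ω i)) (Finset.mem_univ i)) hx
    _ = μ B ^ N := by simp [Measure.pi_pi]
    _ ≤ ENNReal.ofReal (1 - ε) ^ N := by gcongr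
    _ = ENNReal.ofReal ((1 - ε) ^ N) := (ENNReal.ofReal_pow (sub_nonneg.2 hε1) N).symm
end

section
/- Let X ⊆ ℝⁿ be compact and μ a Borel probability measure on ℝⁿ with μ(X) = 1. Let O ⊆ X be nonempty and compact, let A ⊆ O and B ⊆ X\O be nonempty finite sets, and define h(x) := d(x,A) if x ∈ O and h(x) := d(x,B) if x ∉ O. For an integer N ≥ 1 and ω = (x₁,…,x_N) ∈ Xᴺ let δ*(ω) := max_{1≤i≤N} h(x_i). Then for every ε̃ ∈ (0,1], μᴺ({ω ∈ Xᴺ : μ(O ∪ Π(A,B,−δ*(ω))) − ε̃ ≤ μ(O) and μ(O) ≤ μ(O ∩ Π(A,B,δ*(ω))) + ε̃}) ≥ 1 − (1−ε̃)ᴺ. -/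
open MeasureTheory

open scoped Classical in
/-- `h(x) = d(x,A)` if `x ∈ O` and `h(x) = d(x,B)` otherwise. -/
noncomputable def hFun {n : ℕ} (O A B : Set (EuclideanSpace ℝ (Fin n)))
    (x : EuclideanSpace ℝ (Fin n)) : ℝ :=
  if x ∈ O then Metric.infDist x A else Metric.infDist x B

/-- The law of a real random variable `h` satisfies `μ {μ {h > h x} > ε} ≤ 1 - ε`. -/
theorem measure_lt_measure_superlevel_le {α : Type*} [MeasurableSpace α] (μ : Measure α)
    [IsProbabilityMeasure μ] {h : α → ℝ} (hh : Measurable h) (ε : ENNReal) :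
    MeasurableSet {x | ε < μ {y | h x < h y}} ∧ μ {x | ε < μ {y | h x < h y}} ≤ 1 - ε := by
  have hT : MeasurableSet {t : ℝ | ε < μ {y | t < h y}} := by
    refine Set.OrdConnected.measurableSet (IsLowerSet.ordConnected ?_)
    intro a b hba ha
    exact lt_of_lt_of_le ha (measure_mono fun y (hy : a < h y) => lt_of_le_of_lt hba hy)
  refine ⟨hh hT, ?_⟩
  change μ (h ⁻¹' {t : ℝ | ε < μ {y | t < h y}}) ≤ 1 - ε
  have := Measure.isProbabilityMeasure_map (μ := μ) hh.aemeasurable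
  rw [← Measure.map_apply hh hT, hT.measure_eq_iSup_isCompact]
  refine iSup₂_le fun K hKT => iSup_le fun hK => ?_
  rcases K.eq_empty_or_nonempty with rfl | hne
  · simp
  obtain ⟨m, hmK, hm⟩ := hK.exists_isGreatest hne
  calc (μ.map h) K ≤ (μ.map h) (Set.Iic m) := measure_mono hm
    _ = 1 - μ {y | m < h y} := by
      rw [← Set.compl_Ioi, prob_compl_eq_one_sub measurableSet_Ioi,
        Measure.map_apply hh measurableSet_Ioi]
      rfl
    _ ≤ 1 - ε := tsub_le_tsub_left (hKT hmK).le _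

/-- The `μ`-mass above the maximum of `N` independent samples of `h` is at most `ε` with
probability at least `1 - (1 - ε) ^ N`. -/
theorem one_sub_pow_le_pi_measure_superlevel_sampledMax {α : Type*} [MeasurableSpace α]
    (μ : Measure α) [IsProbabilityMeasure μ] {h : α → ℝ} (hh : Measurable h) {N : ℕ} (hN : 1 ≤ N)
    (ε : ENNReal) :
    1 - (1 - ε) ^ N ≤
      (Measure.pi fun _ : Fin N => μ) {ω | μ {y | sampledMax h hN ω < h y} ≤ ε} := by
  obtain ⟨hS, hle⟩ := measure_lt_measure_superlevel_le μ hh ε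
  set S := {x | ε < μ {y | h x < h y}}
  calc 1 - (1 - ε) ^ N ≤ 1 - (Measure.pi fun _ : Fin N => μ) (Set.univ.pi fun _ => S) := by
        rw [Measure.pi_pi, Finset.prod_const, Finset.card_univ, Fintype.card_fin]
        gcongr
    _ = (Measure.pi fun _ : Fin N => μ) (Set.univ.pi fun _ => S)ᶜ :=
        (prob_compl_eq_one_sub (MeasurableSet.univ_pi fun _ => hS)).symm
    _ ≤ _ := by
        refine measure_mono fun ω hω => ?_
        contrapose! hω
        rw [Set.notMem_compl_iff]
        intro i _
        simp only [Set.mem_ofPred_eq, not_le] at hω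
        refine lt_of_lt_of_le hω (measure_mono fun y (hy : _ < h y) => ?_)
        refine lt_of_le_of_lt ?_ hy
        exact Finset.le_sup' (fun i => h (ω i)) (Finset.mem_univ i)

section hFun

variable {n : ℕ} {X O A B : Set (EuclideanSpace ℝ (Fin n))}

theorem measurable_hFun (hO : MeasurableSet O) : Measurable (hFun O A B) := by
  classical
  unfold hFun
  exact Measurable.ite hO (Metric.continuous_infDist_pt A).measurable
    (Metric.continuous_infDist_pt B).measurable

theorem sepSet_neg_diff_subset (hAO : A ⊆ O) (hA : IsClosed A) (hAne : A.Nonempty) (r : ℝ) :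
    sepSet X A B (-r) \ O ⊆ {y | r < hFun O A B y} := by
  rintro x ⟨⟨-, hx⟩, hxO⟩
  have := (hA.notMem_iff_infDist_pos hAne).1 fun h => hxO (hAO h)
  simp only [Set.mem_ofPred_eq, hFun, if_neg hxO]
  linarith

theorem diff_sepSet_subset (hOX : O ⊆ X) (r : ℝ) :
    O \ sepSet X A B r ⊆ {y | r < hFun O A B y} := by
  rintro x ⟨hxO, hx⟩
  have hlt : r < Metric.infDist x A - Metric.infDist x B :=
    not_le.1 fun h => hx ⟨hOX hxO, h⟩
  have := Metric.infDist_nonneg (x := x) (s := B)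
  simp only [Set.mem_ofPred_eq, hFun, if_pos hxO]
  linarith

end hFun

/-- With probability at least `1 − (1−ε̃)^N` over the sample `ω`, the set
`O` is sandwiched (up to measure `ε̃`) between `Π(A,B,−δ*(ω))` and `Π(A,B,δ*(ω))`:
`μ(O ∪ Π(A,B,−δ*(ω))) − ε̃ ≤ μ(O)` and `μ(O) ≤ μ(O ∩ Π(A,B,δ*(ω))) + ε̃`. -/
theorem set_identification_guarantee {n : ℕ} (μ : Measure (EuclideanSpace ℝ (Fin n)))
    [IsProbabilityMeasure μ] (X O A B : Set (EuclideanSpace ℝ (Fin n)))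
    (hX : IsCompact X) (hμX : μ X = 1)
    (hOne : O.Nonempty) (hO : IsCompact O) (hOX : O ⊆ X)
    (hAO : A ⊆ O) (hAfin : A.Finite) (hAne : A.Nonempty)
    (hB : B ⊆ X \ O) (hBfin : B.Finite) (hBne : B.Nonempty)
    (N : ℕ) (hN : 1 ≤ N) (ε : ℝ) (hε0 : 0 < ε) (hε1 : ε ≤ 1) :
    ENNReal.ofReal (1 - (1 - ε) ^ N) ≤
      (Measure.pi fun _ : Fin N => μ)
        {ω : Fin N → EuclideanSpace ℝ (Fin n) |
          μ (O ∪ sepSet X A B (-(sampledMax (hFun O A B) hN ω))) - ENNReal.ofReal ε ≤ μ O ∧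
          μ O ≤ μ (O ∩ sepSet X A B (sampledMax (hFun O A B) hN ω)) + ENNReal.ofReal ε} := by
  have key := one_sub_pow_le_pi_measure_superlevel_sampledMax μ
    (measurable_hFun (A := A) (B := B) hO.measurableSet) hN (ENNReal.ofReal ε)
  have hpow : ENNReal.ofReal (1 - (1 - ε) ^ N) = 1 - (1 - ENNReal.ofReal ε) ^ N := by
    have h1 : 0 ≤ 1 - ε := by linarith
    rw [ENNReal.ofReal_sub _ (by positivity), ENNReal.ofReal_pow h1,
      ENNReal.ofReal_sub _ hε0.le, ENNReal.ofReal_one]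
  rw [hpow]
  refine key.trans (measure_mono fun ω hω => ?_)
  simp only [Set.mem_ofPred_eq] at hω ⊢
  constructor
  · rw [tsub_le_iff_right, ← Set.union_sdiff_self]
    refine (measure_union_le _ _).trans ?_
    gcongr
    exact (measure_mono (sepSet_neg_diff_subset hAO hAfin.isClosed hAne _)).trans hω
  · refine (measure_le_inter_add_sdiff μ O
      (sepSet X A B (sampledMax (hFun O A B) hN ω))).trans ?_
    gcongr
    exact (measure_mono (diff_sepSet_subset hOX _)).trans hω
end
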